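/- arXiv:2604.19229 — 3 statements merged into one kernel-verified Lean document; each statement's English description precedes it below -/
import Mathlib

section
/- If W ∈ ℝ^{2p×2p} is both symmetric and skew-Hamiltonian (i.e. WJ_p = −(WJ_p)ᵀ), then there exists an orthogonal symplectic matrix T ∈ OrSp(2p) such that TᵀWT is the block-diagonal matrix D ⊕ D for some diagonal matrix D ∈ ℝ^{p×p}. -/
open Matrix BigOperators

noncomputable section

/-- The Poisson matrix `J_k = [[0, I],[-I, 0]]`, on index type `Fin k ⊕ Fin k`
(representing dimension `2k`). -/
def Jmat (k : ℕ) : Matrix (Fin k ⊕ Fin k) (Fin k ⊕ Fin k) ℝ :=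
  Matrix.fromBlocks 0 1 (-1) 0

/-- Squared Frobenius norm `‖M‖_F² = tr(Mᵀ M)`. -/
def frobSq {m k : Type*} [Fintype m] [Fintype k] (M : Matrix m k ℝ) : ℝ :=
  Matrix.trace (Mᵀ * M)

/-- The Frobenius norm. -/
def frobNorm {m k : Type*} [Fintype m] [Fintype k] (M : Matrix m k ℝ) : ℝ :=
  Real.sqrt (frobSq M)

/-- The trace-penalty function `f_β`. -/
def fPen (n p : ℕ) (A : Matrix (Fin n ⊕ Fin n) (Fin n ⊕ Fin n) ℝ) (β : ℝ)
    (X : Matrix (Fin n ⊕ Fin n) (Fin p ⊕ Fin p) ℝ) : ℝ :=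
  (1 / 2) * Matrix.trace (Xᵀ * A * X) + (β / 4) * frobSq (Xᵀ * Jmat n * X - Jmat p)

/-- The gradient `∇f_β(X) = AX - βJ_nX(XᵀJ_nX - J_p)`. -/
def gradPen (n p : ℕ) (A : Matrix (Fin n ⊕ Fin n) (Fin n ⊕ Fin n) ℝ) (β : ℝ)
    (X : Matrix (Fin n ⊕ Fin n) (Fin p ⊕ Fin p) ℝ) :
    Matrix (Fin n ⊕ Fin n) (Fin p ⊕ Fin p) ℝ :=
  A * X - β • (Jmat n * X * (Xᵀ * Jmat n * X - Jmat p))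

/-- The real representation `A + iB ↦ [[A, B], [-B, A]]` of complex square matrices. -/
def realRep {n : Type*} (M : Matrix n n ℂ) : Matrix (n ⊕ n) (n ⊕ n) ℝ :=
  Matrix.fromBlocks (M.map Complex.re) (M.map Complex.im) (-M.map Complex.im) (M.map Complex.re)

theorem realRep_mul {n : Type*} [Fintype n] (M N : Matrix n n ℂ) :
    realRep (M * N) = realRep M * realRep N := by
  have hre : (M * N).map Complex.re =
      M.map Complex.re * N.map Complex.re - M.map Complex.im * N.map Complex.im := by
    ext i j
    simp [Matrix.mul_apply, Finset.sum_sub_distrib]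
  have him : (M * N).map Complex.im =
      M.map Complex.re * N.map Complex.im + M.map Complex.im * N.map Complex.re := by
    ext i j
    simp [Matrix.mul_apply, Finset.sum_add_distrib]
  simp only [realRep, hre, him, Matrix.fromBlocks_multiply, Matrix.mul_neg, Matrix.neg_mul]
  congr 1 <;> abel

theorem realRep_star {n : Type*} (M : Matrix n n ℂ) :
    realRep (star M) = (realRep M)ᵀ := by
  ext (i | i) (j | j) <;> simp [realRep, Matrix.star_apply]

theorem realRep_one {n : Type*} [DecidableEq n] : realRep (1 : Matrix n n ℂ) = 1 := by
  ext (i | i) (j | j) <;> simp [realRep, Matrix.one_apply, apply_ite]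

theorem realRep_diagonal_ofReal {n : Type*} [DecidableEq n] (d : n → ℝ) :
    realRep (Matrix.diagonal fun i => (d i : ℂ)) =
      Matrix.fromBlocks (Matrix.diagonal d) 0 0 (Matrix.diagonal d) := by
  ext (i | i) (j | j) <;> by_cases h : i = j <;> simp [realRep, h]

theorem realRep_I_smul_one (k : ℕ) :
    realRep (Complex.I • (1 : Matrix (Fin k) (Fin k) ℂ)) = Jmat k := by
  ext (i | i) (j | j) <;> simp [realRep, Jmat, Matrix.one_apply, apply_ite]

theorem exists_isHermitian_realRep_eq (p : ℕ) (W : Matrix (Fin p ⊕ Fin p) (Fin p ⊕ Fin p) ℝ)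
    (hsymm : Wᵀ = W) (hskewHam : W * Jmat p = -(W * Jmat p)ᵀ) :
    ∃ H : Matrix (Fin p) (Fin p) ℂ, H.IsHermitian ∧ realRep H = W := by
  obtain ⟨A, B, C, E, rfl⟩ : ∃ A B C E, W = Matrix.fromBlocks A B C E :=
    ⟨_, _, _, _, (Matrix.fromBlocks_toBlocks W).symm⟩
  simp only [Jmat, Matrix.fromBlocks_multiply, Matrix.fromBlocks_transpose,
    Matrix.fromBlocks_neg, Matrix.fromBlocks_inj, Matrix.mul_zero, Matrix.mul_one,
    Matrix.mul_neg, zero_add, add_zero, Matrix.transpose_neg, neg_neg] at hsymm hskewHam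
  obtain ⟨hA, -, hB, -⟩ := hsymm
  obtain ⟨hBskew, hAE, -, -⟩ := hskewHam
  have hB' : B = -C := by rw [← hB, ← hBskew, neg_neg]
  have hE : E = A := by rw [← hA, hAE]; simp
  subst hE
  refine ⟨Matrix.of fun i j => ⟨E i j, B i j⟩, ?_, ?_⟩
  · ext i j
    apply Complex.ext
    · simpa using congrFun₂ hA i j
    · have h := congrFun₂ hBskew i j
      simp only [Matrix.neg_apply, Matrix.transpose_apply] at h
      simp [← h]
  · ext (i | i) (j | j) <;> simp [realRep, hB']

theorem stmt1 (p : ℕ) (W : Matrix (Fin p ⊕ Fin p) (Fin p ⊕ Fin p) ℝ)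
    (hsymm : Wᵀ = W)
    (hskewHam : W * Jmat p = -(W * Jmat p)ᵀ) :
    ∃ T : Matrix (Fin p ⊕ Fin p) (Fin p ⊕ Fin p) ℝ,
      Tᵀ * Jmat p * T = Jmat p ∧ Tᵀ * T = 1 ∧
      ∃ D : Fin p → ℝ,
        Tᵀ * W * T = Matrix.fromBlocks (Matrix.diagonal D) 0 0 (Matrix.diagonal D) := by
  obtain ⟨H, hH, rfl⟩ := exists_isHermitian_realRep_eq p W hsymm hskewHam
  set U : Matrix (Fin p) (Fin p) ℂ := ↑hH.eigenvectorUnitary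
  have hUU : star U * U = 1 := Unitary.coe_star_mul_self hH.eigenvectorUnitary
  refine ⟨realRep U, ?_, ?_, hH.eigenvalues, ?_⟩
  · rw [← realRep_I_smul_one, ← realRep_star, ← realRep_mul, ← realRep_mul]
    simp [hUU]
  · rw [← realRep_star, ← realRep_mul, hUU, realRep_one]
  · have hdiag := hH.conjStarAlgAut_star_eigenvectorUnitary
    rw [Unitary.conjStarAlgAut_star_apply] at hdiag
    rw [← realRep_star, ← realRep_mul, ← realRep_mul, hdiag]
    exact realRep_diagonal_ofReal hH.eigenvalues
end
end

section
/- Let X ∈ ℝ^{2n×2p} be such that the skew-symmetric matrix XᵀJ_nX is nonsingular. Then X admits a symplectic singular value decomposition X = SΣTᵀ, where S ∈ Sp(2p,2n), T ∈ ℝ^{2p×2p} is orthogonal, and Σ = Diag(σ₁, …, σ_p, σ₁, …, σ_p) is diagonal with 0 < σ₁ ≤ σ₂ ≤ … ≤ σ_p. -/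
open Matrix BigOperators

noncomputable section

/-- An injective skew-adjoint operator on a Euclidean space of dimension `2p` splits into `p`
scaled plane rotations acting on mutually orthogonal planes. -/
theorem LinearMap.exists_orthonormal_of_skewAdjoint (p : ℕ) :
    ∀ {E : Type*} [NormedAddCommGroup E] [InnerProductSpace ℝ E] [FiniteDimensional ℝ E]
      (A : E →ₗ[ℝ] E), (∀ x y, inner ℝ (A x) y = -inner ℝ x (A y)) →
      Function.Injective A → Module.finrank ℝ E = 2 * p →
      ∃ (b : Fin p ⊕ Fin p → E) (l : Fin p → ℝ), Orthonormal ℝ b ∧ (∀ i, 0 < l i) ∧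
        ∀ i, A (b (Sum.inr i)) = l i • b (Sum.inl i) ∧
          A (b (Sum.inl i)) = -(l i • b (Sum.inr i)) := by
  induction p with
  | zero =>
    intro E _ _ _ A _ _ _
    exact ⟨fun i => i.elim Fin.elim0 Fin.elim0, Fin.elim0,
      ⟨fun i => (i.elim Fin.elim0 Fin.elim0 : False).elim,
        fun i => (i.elim Fin.elim0 Fin.elim0 : False).elim⟩, fun i => i.elim0, fun i => i.elim0⟩
  | succ p ih =>
    intro E _ _ _ A hA hinj hdim
    have : Nontrivial E := Module.nontrivial_of_finrank_pos (R := ℝ) (by omega)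
    have hsymm : (-(A ∘ₗ A)).IsSymmetric := by
      intro x y
      simp [hA]
    obtain ⟨u, hu, hu1⟩ : ∃ u, Module.End.HasEigenvector (-(A ∘ₗ A)) (hsymm.eigenvalues rfl
        ⟨0, by omega⟩) u ∧ ‖u‖ = 1 :=
      ⟨_, hsymm.hasEigenvector_eigenvectorBasis rfl ⟨0, by omega⟩,
        (hsymm.eigenvectorBasis rfl).orthonormal.1 _⟩
    have hAA : A (A u) = -(hsymm.eigenvalues rfl ⟨0, by omega⟩ • u) := by
      rw [← hu.apply_eq_smul]; simp
    generalize hsymm.eigenvalues rfl ⟨0, by omega⟩ = μ at hAA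
    have hu0 : u ≠ 0 := by rintro rfl; simp at hu1
    have hAu : A u ≠ 0 := fun h => hu0 (hinj (by simpa using h))
    have hμ : μ = ‖A u‖ ^ 2 := by
      rw [← real_inner_self_eq_norm_sq, hA, hAA, inner_neg_right, inner_smul_right,
        real_inner_self_eq_norm_sq, hu1]
      ring
    set r := ‖A u‖ with hr
    have hr0 : 0 < r := norm_pos_iff.2 hAu
    obtain ⟨v, hv⟩ : ∃ v, v = r⁻¹ • A u := ⟨_, rfl⟩
    have hAuv : A u = r • v := by rw [hv, smul_inv_smul₀ hr0.ne']
    have hAvu : A v = -(r • u) := by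
      rw [hv, map_smul, hAA, hμ, smul_neg, smul_smul]
      congr 2
      field_simp
    have hv1 : ‖v‖ = 1 := by
      rw [hv, norm_smul, norm_inv, Real.norm_of_nonneg hr0.le, ← hr, inv_mul_cancel₀ hr0.ne']
    have huv : inner ℝ u v = 0 := by
      have h1 := hA u u
      rw [hAuv, inner_smul_left, inner_smul_right, real_inner_comm] at h1
      simp only [conj_trivial] at h1
      nlinarith
    have hvu : inner ℝ v u = 0 := by rw [real_inner_comm, huv]
    have hon : Orthonormal ℝ ![u, v] := by
      simp [orthonormal_iff_ite, Fin.forall_fin_two, hu1, hv1, huv, hvu]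
    set K := (Submodule.span ℝ (Set.range ![u, v]))ᗮ with hK
    have memK (x : E) : x ∈ K ↔ inner ℝ u x = 0 ∧ inner ℝ v x = 0 := by
      rw [hK, Submodule.mem_orthogonal]
      constructor
      · intro h
        exact ⟨h u (Submodule.subset_span ⟨0, rfl⟩), h v (Submodule.subset_span ⟨1, rfl⟩)⟩
      · rintro ⟨h1, h2⟩ y hy
        rw [Matrix.range_cons_cons_empty, Submodule.mem_span_pair] at hy
        obtain ⟨a, c, rfl⟩ := hy
        simp [inner_add_left, inner_smul_left, h1, h2]
    have hKdim : Module.finrank ℝ K = 2 * p := by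
      have h1 := (Submodule.span ℝ (Set.range ![u, v])).finrank_add_finrank_orthogonal
      rw [← hK, finrank_span_eq_card hon.linearIndependent, hdim, Fintype.card_fin] at h1
      omega
    have hinv : ∀ x ∈ K, A x ∈ K := by
      intro x hx
      rw [memK] at hx ⊢
      have h1 := hA u x
      have h2 := hA v x
      rw [hAuv, inner_smul_left, hx.2] at h1
      rw [hAvu, inner_neg_left, inner_smul_left, hx.1] at h2
      simp only [mul_zero, neg_zero] at h1 h2
      constructor <;> linarith
    obtain ⟨b, l, hb, hl, hAb⟩ := ih (A.restrict hinv)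
      (fun x y => hA x y) (fun x y h => Subtype.ext (hinj (congrArg Subtype.val h))) hKdim
    have hbu (i) : inner ℝ u (b i : E) = 0 := ((memK _).1 (b i).2).1
    have hbv (i) : inner ℝ v (b i : E) = 0 := ((memK _).1 (b i).2).2
    have hub (i) : inner ℝ (b i : E) u = 0 := by rw [real_inner_comm, hbu]
    have hvb (i) : inner ℝ (b i : E) v = 0 := by rw [real_inner_comm, hbv]
    have hbb (i j) : inner ℝ (b i : E) (b j) = if i = j then (1 : ℝ) else 0 :=
      orthonormal_iff_ite.1 hb i j
    refine ⟨Sum.elim (Fin.cons v fun i => b (Sum.inl i)) (Fin.cons u fun i => b (Sum.inr i)),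
      Fin.cons r l, ?_, Fin.cases hr0 hl, Fin.cases ⟨hAuv, hAvu⟩ fun i =>
        ⟨congrArg Subtype.val (hAb i).1, congrArg Subtype.val (hAb i).2⟩⟩
    rw [orthonormal_iff_ite]
    simp [Fin.forall_fin_succ, hu1, hv1, huv, hvu, hbu, hbv, hub, hvb, hbb, Fin.succ_ne_zero,
      (Fin.succ_ne_zero _).symm]

/-- A nonsingular real skew-symmetric matrix is orthogonally similar to a block matrix
`[[0, Λ], [-Λ, 0]]` with `Λ` positive diagonal and increasing. -/
theorem Matrix.exists_orthogonal_mul_eq_of_skewSymmetric {p : ℕ}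
    (M : Matrix (Fin p ⊕ Fin p) (Fin p ⊕ Fin p) ℝ) (hM : Mᵀ = -M) (hdet : IsUnit M.det) :
    ∃ (T : Matrix (Fin p ⊕ Fin p) (Fin p ⊕ Fin p) ℝ) (l : Fin p → ℝ),
      Tᵀ * T = 1 ∧ Monotone l ∧ (∀ i, 0 < l i) ∧
      M * T = T * fromBlocks 0 (diagonal l) (-diagonal l) 0 := by
  obtain ⟨b, l, hb, hl, hAb⟩ := LinearMap.exists_orthonormal_of_skewAdjoint p
    (Matrix.toEuclideanLin M)
    (fun x y => by
      rw [← LinearMap.adjoint_inner_right, ← Matrix.toEuclideanLin_conjTranspose_eq_adjoint,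
        conjTranspose_eq_transpose_of_trivial, hM]
      simp)
    (fun x y h => by
      have h1 := congrArg WithLp.ofLp h
      simp only [Matrix.toLpLin_apply] at h1
      exact WithLp.ofLp_injective 2
        (Matrix.mulVec_injective_of_isUnit ((isUnit_iff_isUnit_det M).2 hdet) h1))
    (by simp [two_mul])
  have hb' := orthonormal_iff_ite.1 (hb.comp (Sum.map (Tuple.sort l) (Tuple.sort l))
    (Sum.map_injective.2 ⟨(Tuple.sort l).injective, (Tuple.sort l).injective⟩))
  refine ⟨of fun i j => b (Sum.map (Tuple.sort l) (Tuple.sort l) j) i, l ∘ Tuple.sort l, ?_,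
    Tuple.monotone_sort l, fun i => hl _, ?_⟩
  · ext i j
    rw [one_apply, ← hb' i j]
    simp [mul_apply, PiLp.inner_apply, mul_comm]
  · ext i (j | j)
    · have := congrArg (fun x : EuclideanSpace ℝ (Fin p ⊕ Fin p) => x i) (hAb (Tuple.sort l j)).2
      simpa [Matrix.toLpLin_apply, mulVec, dotProduct, mul_apply, diagonal_apply,
        mul_comm] using this
    · have := congrArg (fun x : EuclideanSpace ℝ (Fin p ⊕ Fin p) => x i) (hAb (Tuple.sort l j)).1
      simpa [Matrix.toLpLin_apply, mulVec, dotProduct, mul_apply, diagonal_apply,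
        mul_comm] using this

theorem stmt3 (n p : ℕ) (X : Matrix (Fin n ⊕ Fin n) (Fin p ⊕ Fin p) ℝ)
    (hns : IsUnit (Xᵀ * Jmat n * X).det) :
    ∃ (S : Matrix (Fin n ⊕ Fin n) (Fin p ⊕ Fin p) ℝ)
      (T : Matrix (Fin p ⊕ Fin p) (Fin p ⊕ Fin p) ℝ) (σ : Fin p → ℝ),
      Sᵀ * Jmat n * S = Jmat p ∧ Tᵀ * T = 1 ∧
      Monotone σ ∧ (∀ i, 0 < σ i) ∧
      X = S * Matrix.diagonal (Sum.elim σ σ) * Tᵀ := by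
  have hJ : (Jmat n)ᵀ = -Jmat n := by simp [Jmat, fromBlocks_transpose, fromBlocks_neg]
  obtain ⟨T, l, hT, hl, hl0, hMT⟩ := Matrix.exists_orthogonal_mul_eq_of_skewSymmetric
    (Xᵀ * Jmat n * X) (by simp [transpose_mul, hJ, Matrix.mul_assoc]) hns
  have hs (i) : √(l i) ≠ 0 := (Real.sqrt_pos.2 (hl0 i)).ne'
  set D : Matrix (Fin p ⊕ Fin p) (Fin p ⊕ Fin p) ℝ :=
    diagonal (Sum.elim (fun i => (√(l i))⁻¹) fun i => (√(l i))⁻¹) with hD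
  refine ⟨X * T * D, T, fun i => √(l i), ?_, hT, fun i j h => Real.sqrt_le_sqrt (hl h),
    fun i => Real.sqrt_pos.2 (hl0 i), ?_⟩
  · calc (X * T * D)ᵀ * Jmat n * (X * T * D) = D * (Tᵀ * (Xᵀ * Jmat n * X * T)) * D := by
          simp [hD, transpose_mul, Matrix.mul_assoc]
      _ = D * fromBlocks 0 (diagonal l) (-diagonal l) 0 * D := by
          rw [hMT, ← Matrix.mul_assoc Tᵀ, hT, Matrix.one_mul]
      _ = Jmat p := by
          have h (i) : (√(l i))⁻¹ * l i * (√(l i))⁻¹ = 1 := by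
            have := Real.mul_self_sqrt (hl0 i).le
            have := hs i
            field_simp
            linarith
          rw [hD, ← fromBlocks_diagonal, Jmat]
          simp [fromBlocks_multiply, h, -fromBlocks_diagonal, -diagonal_neg]
  · have hDD : D * diagonal (Sum.elim (fun i => √(l i)) fun i => √(l i)) = 1 := by
      rw [hD, diagonal_mul_diagonal, ← diagonal_one]
      congr 1
      ext (i | i) <;> simp [hs]
    rw [Matrix.mul_assoc (X * T), hDD, Matrix.mul_one, Matrix.mul_assoc,
      mul_eq_one_comm.1 hT, Matrix.mul_one]
end
end

section
/- Let A ∈ ℝ^{2n×2n} be symmetric positive definite with symplectic eigenvalues 0 < d₁ ≤ … ≤ d_n, and let β > d_p for some 1 ≤ p ≤ n. Then every global minimizer X of f_β over ℝ^{2n×2p} has the form X = S̄(I_{2p} − D̄/β)^{1/2}Tᵀ, where S̄ ∈ Sp(2p,2n) satisfies S̄ᵀAS̄ = D̄ := Diag(d₁,…,d_p,d₁,…,d_p) and T ∈ OrSp(2p). -/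
open Matrix BigOperators

noncomputable section

lemma Jmat_transpose (k : ℕ) : (Jmat k)ᵀ = -Jmat k := by
  simp [Jmat, Matrix.fromBlocks_transpose, Matrix.fromBlocks_neg]

lemma Jmat_mul_self (k : ℕ) : Jmat k * Jmat k = -1 := by
  simp [Jmat, Matrix.fromBlocks_multiply, ← Matrix.fromBlocks_one, Matrix.fromBlocks_neg]

lemma Jmat_mul_diagonal (k : ℕ) (a : Fin k → ℝ) :
    Jmat k * diagonal (Sum.elim a a) = diagonal (Sum.elim a a) * Jmat k := by
  simp [Jmat, ← Matrix.fromBlocks_diagonal, Matrix.fromBlocks_multiply]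

lemma Jmat_mul_diagonal_sub (k : ℕ) (a : Fin k → ℝ) :
    Jmat k * diagonal (Sum.elim a a) - Jmat k =
      Jmat k * diagonal (Sum.elim (fun i => a i - 1) fun i => a i - 1) := by
  have h : diagonal (Sum.elim (fun i => a i - 1) fun i => a i - 1) =
      diagonal (Sum.elim a a) - 1 := by
    rw [← Matrix.diagonal_one, Matrix.diagonal_sub]
    congr 1
    ext (i | i) <;> rfl
  rw [h, Matrix.mul_sub, Matrix.mul_one]

lemma eq_zero_of_quartic_nonneg {L Q C E : ℝ}
    (h : ∀ t : ℝ, 0 ≤ t * L + t ^ 2 * Q + t ^ 3 * C + t ^ 4 * E) : L = 0 := by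
  have hd : HasDerivAt (fun t : ℝ => t * L + t ^ 2 * Q + t ^ 3 * C + t ^ 4 * E) L 0 := by
    have hpow (m : ℕ) (x : ℝ) := (hasDerivAt_pow m (0 : ℝ)).mul_const x
    have := (((hpow 1 L).fun_add (hpow 2 Q)).fun_add (hpow 3 C)).fun_add (hpow 4 E)
    simpa using this
  refine IsLocalMin.hasDerivAt_eq_zero
    (f := fun t : ℝ => t * L + t ^ 2 * Q + t ^ 3 * C + t ^ 4 * E) ?_ hd
  refine Filter.Eventually.of_forall fun t => ?_
  simpa using h t

lemma frobSq_add_smul {m k : Type*} [Fintype m] [Fintype k] (M N : Matrix m k ℝ) (t : ℝ) :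
    frobSq (M + t • N) = frobSq M + t * (2 * (Mᵀ * N).trace) + t ^ 2 * frobSq N := by
  have h : (Nᵀ * M).trace = (Mᵀ * N).trace := by
    rw [← Matrix.trace_transpose, Matrix.transpose_mul, Matrix.transpose_transpose]
  simp only [frobSq, Matrix.transpose_add, Matrix.transpose_smul, Matrix.add_mul, Matrix.mul_add,
    Matrix.trace_add, Matrix.smul_mul, Matrix.mul_smul, Matrix.trace_smul, smul_eq_mul, h]
  ring

lemma transpose_conj_Jmat {n p : ℕ} (X : Matrix (Fin n ⊕ Fin n) (Fin p ⊕ Fin p) ℝ) :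
    (Xᵀ * Jmat n * X)ᵀ = -(Xᵀ * Jmat n * X) := by
  simp [Matrix.transpose_mul, Jmat_transpose, Matrix.mul_assoc]

/-- The expansion of `fPen` along a line is a quartic whose linear coefficient is the pairing
with `gradPen`. -/
lemma fPen_add_smul {n p : ℕ} {A : Matrix (Fin n ⊕ Fin n) (Fin n ⊕ Fin n) ℝ} (hA : Aᵀ = A)
    (β : ℝ) (X Z : Matrix (Fin n ⊕ Fin n) (Fin p ⊕ Fin p) ℝ) :
    ∃ Q C E : ℝ, ∀ t : ℝ, fPen n p A β (X + t • Z) = fPen n p A β X +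
      (t * (Zᵀ * gradPen n p A β X).trace + t ^ 2 * Q + t ^ 3 * C + t ^ 4 * E) := by
  set M := Xᵀ * Jmat n * X - Jmat p with hM
  have hMt : Mᵀ = -M := by
    rw [hM, Matrix.transpose_sub, transpose_conj_Jmat, Jmat_transpose]; abel
  set N := Xᵀ * Jmat n * Z + Zᵀ * Jmat n * X with hN
  set R := Zᵀ * Jmat n * Z with hR
  have h1 : (Xᵀ * A * Z).trace = (Zᵀ * A * X).trace := by
    rw [← Matrix.trace_transpose]
    simp [Matrix.transpose_mul, hA, Matrix.mul_assoc]
  have h2 : (M * (Xᵀ * Jmat n * Z)).trace = (M * (Zᵀ * Jmat n * X)).trace := by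
    rw [← Matrix.trace_transpose]
    simp only [Matrix.transpose_mul, hMt, Jmat_transpose, Matrix.transpose_transpose,
      Matrix.mul_neg, Matrix.neg_mul, neg_neg, Matrix.mul_assoc]
    rw [Matrix.trace_mul_comm M]
    simp only [Matrix.mul_assoc]
  have h3 : (M * (Zᵀ * Jmat n * X)).trace = (Zᵀ * (Jmat n * X * M)).trace := by
    rw [Matrix.trace_mul_comm]
    simp only [Matrix.mul_assoc]
  refine ⟨(1/2) * (Zᵀ * A * Z).trace + β / 4 * (frobSq N + 2 * (Mᵀ * R).trace),
    β / 4 * (2 * (Nᵀ * R).trace), β / 4 * frobSq R, fun t => ?_⟩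
  have e1 : (X + t • Z)ᵀ * Jmat n * (X + t • Z) - Jmat p = (M + t • (N + t • R)) := by
    simp only [hM, hN, hR, Matrix.transpose_add, Matrix.transpose_smul, Matrix.add_mul,
      Matrix.mul_add, Matrix.smul_mul, Matrix.mul_smul, smul_add]
    abel
  have e2 : ((X + t • Z)ᵀ * A * (X + t • Z)).trace = (Xᵀ * A * X).trace
      + t * (2 * (Zᵀ * A * X).trace) + t ^ 2 * (Zᵀ * A * Z).trace := by
    simp only [Matrix.transpose_add, Matrix.transpose_smul, Matrix.add_mul,
      Matrix.mul_add, Matrix.smul_mul, Matrix.mul_smul, Matrix.trace_add, Matrix.trace_smul,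
      smul_eq_mul, h1]
    ring
  have e3 : (Mᵀ * N).trace = -2 * (Zᵀ * (Jmat n * X * M)).trace := by
    rw [hMt, hN, Matrix.neg_mul, Matrix.trace_neg, Matrix.mul_add, Matrix.trace_add, h2, h3]
    ring
  have e4 : (Zᵀ * gradPen n p A β X).trace
      = (Zᵀ * A * X).trace - β * (Zᵀ * (Jmat n * X * M)).trace := by
    rw [gradPen, ← hM, Matrix.mul_sub, Matrix.trace_sub, Matrix.mul_smul, Matrix.trace_smul,
      smul_eq_mul, ← Matrix.mul_assoc Zᵀ A]
  unfold fPen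
  rw [e1, e2, e4, frobSq_add_smul, frobSq_add_smul, Matrix.mul_add, Matrix.trace_add,
    Matrix.mul_smul, Matrix.trace_smul, e3, ← hM, smul_eq_mul]
  ring

lemma gradPen_eq_zero_of_isMin {n p : ℕ} {A : Matrix (Fin n ⊕ Fin n) (Fin n ⊕ Fin n) ℝ}
    (hA : Aᵀ = A) {β : ℝ} {X : Matrix (Fin n ⊕ Fin n) (Fin p ⊕ Fin p) ℝ}
    (hmin : ∀ Y, fPen n p A β X ≤ fPen n p A β Y) : gradPen n p A β X = 0 := by
  obtain ⟨Q, C, E, h⟩ := fPen_add_smul hA β X (gradPen n p A β X)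
  have h0 : ((gradPen n p A β X)ᵀ * gradPen n p A β X).trace = 0 :=
    eq_zero_of_quartic_nonneg (Q := Q) (C := C) (E := E) fun t => by
      have := hmin (X + t • gradPen n p A β X)
      rw [h t] at this
      linarith
  rw [← Matrix.conjTranspose_eq_transpose_of_trivial] at h0
  exact Matrix.trace_conjTranspose_mul_self_eq_zero_iff.mp h0

/-- A Hermitian matrix has a unitary diagonalization with decreasing eigenvalues. -/
lemma exists_unitary_diagonal_antitone {p : ℕ} {M : Matrix (Fin p) (Fin p) ℂ}
    (hM : M.IsHermitian) : ∃ (U : Matrix (Fin p) (Fin p) ℂ) (h : Fin p → ℝ), Antitone h ∧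
      Uᴴ * U = 1 ∧ Uᴴ * M * U = diagonal fun i => (h i : ℂ) := by
  set σ : Equiv.Perm (Fin p) := Tuple.sort fun i => -hM.eigenvalues i with hσ
  set V : Matrix (Fin p) (Fin p) ℂ := (hM.eigenvectorUnitary : Matrix (Fin p) (Fin p) ℂ) with hV
  have hVV : Vᴴ * V = 1 := by
    have := Unitary.coe_star_mul_self hM.eigenvectorUnitary
    rwa [Matrix.star_eq_conjTranspose] at this
  have hMV : Vᴴ * M * V = diagonal fun i => (hM.eigenvalues i : ℂ) := by
    have h1 := hM.spectral_theorem
    rw [Unitary.conjStarAlgAut_apply, Matrix.star_eq_conjTranspose, ← hV] at h1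
    have h2 : Vᴴ * M * V = (Vᴴ * V) * diagonal (RCLike.ofReal ∘ hM.eigenvalues) * (Vᴴ * V) := by
      conv_lhs => rw [h1]
      simp only [Matrix.mul_assoc]
    rw [h2, hVV, one_mul, mul_one]
    rfl
  refine ⟨V.submatrix id σ, hM.eigenvalues ∘ σ, ?_, ?_, ?_⟩
  · intro i j hij
    have := Tuple.monotone_sort (fun i => -hM.eigenvalues i) hij
    simpa using this
  · have : (V.submatrix id σ)ᴴ * V.submatrix id σ = (Vᴴ * V).submatrix σ σ := rfl
    rw [this, hVV, Matrix.submatrix_one_equiv]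
  · have : (V.submatrix id σ)ᴴ * M * V.submatrix id σ = (Vᴴ * M * V).submatrix σ σ := rfl
    rw [this, hMV, Matrix.submatrix_diagonal_equiv]
    rfl

/-- The real `2p × 2p` matrix of a complex `p × p` matrix. -/
def realBlock {p : ℕ} (M : Matrix (Fin p) (Fin p) ℂ) : Matrix (Fin p ⊕ Fin p) (Fin p ⊕ Fin p) ℝ :=
  fromBlocks (M.map Complex.re) (-M.map Complex.im) (M.map Complex.im) (M.map Complex.re)

lemma realBlock_mul {p : ℕ} (M N : Matrix (Fin p) (Fin p) ℂ) :
    realBlock (M * N) = realBlock M * realBlock N := by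
  simp only [realBlock, Matrix.fromBlocks_multiply]
  congr 1 <;> ext i j <;>
    simp [Matrix.mul_apply, Finset.sum_add_distrib, Finset.sum_sub_distrib] <;> ring

lemma realBlock_conjTranspose {p : ℕ} (M : Matrix (Fin p) (Fin p) ℂ) :
    realBlock Mᴴ = (realBlock M)ᵀ := by
  simp only [realBlock, Matrix.fromBlocks_transpose]
  congr 1 <;> (ext i j; simp)

lemma realBlock_diagonal {p : ℕ} (h : Fin p → ℝ) :
    realBlock (diagonal fun i => (h i : ℂ)) = diagonal (Sum.elim h h) := by
  rw [← Matrix.fromBlocks_diagonal, realBlock]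
  congr 1 <;> ext i j <;> by_cases hij : i = j <;> simp [hij]

lemma realBlock_one {p : ℕ} : realBlock (1 : Matrix (Fin p) (Fin p) ℂ) = 1 := by
  have := realBlock_diagonal (p := p) fun _ => 1
  simpa using this

lemma Jmat_mul_realBlock {p : ℕ} (M : Matrix (Fin p) (Fin p) ℂ) :
    Jmat p * realBlock M = realBlock M * Jmat p := by
  simp [Jmat, realBlock, Matrix.fromBlocks_multiply]

/-- A symmetric matrix commuting with `J` is diagonalized by an orthosymplectic matrix. -/
lemma exists_orthosymplectic_diagonal {p : ℕ} {N : Matrix (Fin p ⊕ Fin p) (Fin p ⊕ Fin p) ℝ}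
    (hsymm : Nᵀ = N) (hcomm : Jmat p * N = N * Jmat p) :
    ∃ (T : Matrix (Fin p ⊕ Fin p) (Fin p ⊕ Fin p) ℝ) (h : Fin p → ℝ), Antitone h ∧
      Tᵀ * Jmat p * T = Jmat p ∧ Tᵀ * T = 1 ∧ Tᵀ * N * T = diagonal (Sum.elim h h) := by
  obtain ⟨P, B, C, R, rfl⟩ : ∃ P B C R, N = fromBlocks P B C R :=
    ⟨_, _, _, _, (Matrix.fromBlocks_toBlocks N).symm⟩
  simp only [Jmat, Matrix.fromBlocks_multiply, Matrix.fromBlocks_transpose,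
    Matrix.fromBlocks_inj, zero_mul, mul_zero, one_mul, mul_one, zero_add, add_zero,
    neg_mul, mul_neg] at hcomm hsymm
  obtain ⟨hCB, hRP, -, -⟩ := hcomm
  obtain ⟨hP, hC, hB, -⟩ := hsymm
  subst hCB
  subst hRP
  set M : Matrix (Fin p) (Fin p) ℂ := Matrix.of fun i j => ⟨R i j, -B i j⟩ with hMdef
  have hMN : fromBlocks R B (-B) R = realBlock M := by
    rw [realBlock]
    congr 1 <;> (ext i j; simp [hMdef])
  have hM : M.IsHermitian := by
    ext i j
    have h1 := congrFun (congrFun hP i) j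
    have h2 := congrFun (congrFun hB i) j
    simp only [Matrix.transpose_apply, Matrix.neg_apply] at h1 h2
    apply Complex.ext <;> simp [hMdef, h1, h2]
  obtain ⟨U, h, hanti, hU, hUM⟩ := exists_unitary_diagonal_antitone hM
  have hT : (realBlock U)ᵀ * realBlock U = 1 := by
    rw [← realBlock_conjTranspose, ← realBlock_mul, hU, realBlock_one]
  refine ⟨realBlock U, h, hanti, ?_, hT, ?_⟩
  · rw [mul_assoc, Jmat_mul_realBlock, ← mul_assoc, hT, one_mul]
  · rw [hMN, ← realBlock_conjTranspose, ← realBlock_mul, ← realBlock_mul, hUM, realBlock_diagonal]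

lemma fPen_mul_orthosymplectic {n p : ℕ} (A : Matrix (Fin n ⊕ Fin n) (Fin n ⊕ Fin n) ℝ) (β : ℝ)
    (X : Matrix (Fin n ⊕ Fin n) (Fin p ⊕ Fin p) ℝ) {T : Matrix (Fin p ⊕ Fin p) (Fin p ⊕ Fin p) ℝ}
    (hTJ : Tᵀ * Jmat p * T = Jmat p) (hT : Tᵀ * T = 1) :
    fPen n p A β (X * T) = fPen n p A β X := by
  have hT' : T * Tᵀ = 1 := mul_eq_one_comm.mp hT
  have h1 : ((X * T)ᵀ * A * (X * T)).trace = (Xᵀ * A * X).trace := by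
    calc _ = (Tᵀ * ((Xᵀ * A * X) * T)).trace := by
          simp only [Matrix.transpose_mul, Matrix.mul_assoc]
      _ = _ := by rw [Matrix.trace_mul_comm, Matrix.mul_assoc, hT', Matrix.mul_one]
  have h2 : (X * T)ᵀ * Jmat n * (X * T) - Jmat p = Tᵀ * ((Xᵀ * Jmat n * X - Jmat p) * T) := by
    rw [Matrix.sub_mul, Matrix.mul_sub, ← Matrix.mul_assoc Tᵀ (Jmat p), hTJ]
    simp only [Matrix.transpose_mul, Matrix.mul_assoc]
  have h3 (M : Matrix (Fin p ⊕ Fin p) (Fin p ⊕ Fin p) ℝ) :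
      frobSq (Tᵀ * (M * T)) = frobSq M := by
    calc _ = (Tᵀ * ((Mᵀ * ((T * Tᵀ) * M)) * T)).trace := by
          simp only [frobSq, Matrix.transpose_mul, Matrix.transpose_transpose, Matrix.mul_assoc]
      _ = _ := by
          rw [Matrix.trace_mul_comm, Matrix.mul_assoc, hT', Matrix.mul_one, Matrix.one_mul, frobSq]
  rw [fPen, fPen, h1, h2, h3]

lemma fPen_of_diagonal {n p : ℕ} {A : Matrix (Fin n ⊕ Fin n) (Fin n ⊕ Fin n) ℝ} {β : ℝ}
    {X : Matrix (Fin n ⊕ Fin n) (Fin p ⊕ Fin p) ℝ} {h : Fin p → ℝ}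
    (hJ : Xᵀ * Jmat n * X = Jmat p * diagonal (Sum.elim h h))
    (hA : Xᵀ * A * X = diagonal
      (Sum.elim (fun i => β * (h i * (1 - h i))) fun i => β * (h i * (1 - h i)))) :
    fPen n p A β X = β / 2 * ∑ i, (1 - h i ^ 2) := by
  have hM : Xᵀ * Jmat n * X - Jmat p =
      Jmat p * diagonal (Sum.elim (fun i => h i - 1) fun i => h i - 1) := by
    rw [hJ, Jmat_mul_diagonal_sub]
  rw [fPen, hA, hM, frobSq, Matrix.transpose_mul, Jmat_transpose, Matrix.mul_neg, Matrix.neg_mul,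
    Matrix.mul_assoc, ← Matrix.mul_assoc (Jmat p), Jmat_mul_self]
  simp only [Matrix.neg_mul, Matrix.mul_neg, Matrix.one_mul, neg_neg, Matrix.diagonal_transpose,
    Matrix.diagonal_mul_diagonal, Matrix.trace_diagonal, Fintype.sum_sum_type, Sum.elim_inl,
    Sum.elim_inr, Finset.mul_sum, ← Finset.sum_add_distrib]
  exact Finset.sum_congr rfl fun i _ => by ring

lemma transpose_conj_mul_diagonal {n p : ℕ} {A : Matrix (Fin n ⊕ Fin n) (Fin n ⊕ Fin n) ℝ}
    {X : Matrix (Fin n ⊕ Fin n) (Fin p ⊕ Fin p) ℝ} {a c : Fin p → ℝ}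
    (hA : Xᵀ * A * X = diagonal (Sum.elim a a)) :
    (X * diagonal (Sum.elim c c))ᵀ * A * (X * diagonal (Sum.elim c c)) =
      diagonal (Sum.elim (fun i => c i ^ 2 * a i) fun i => c i ^ 2 * a i) := by
  calc _ = diagonal (Sum.elim c c) * (Xᵀ * A * X) * diagonal (Sum.elim c c) := by
        simp only [Matrix.transpose_mul, Matrix.diagonal_transpose, Matrix.mul_assoc]
    _ = _ := by
        rw [hA, Matrix.diagonal_mul_diagonal, Matrix.diagonal_mul_diagonal]
        congr 1
        ext (i | i) <;> simp <;> ring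

lemma transpose_conj_Jmat_mul_diagonal {n p : ℕ}
    {X : Matrix (Fin n ⊕ Fin n) (Fin p ⊕ Fin p) ℝ} {a c : Fin p → ℝ}
    (hJ : Xᵀ * Jmat n * X = Jmat p * diagonal (Sum.elim a a)) :
    (X * diagonal (Sum.elim c c))ᵀ * Jmat n * (X * diagonal (Sum.elim c c)) =
      Jmat p * diagonal (Sum.elim (fun i => c i ^ 2 * a i) fun i => c i ^ 2 * a i) := by
  calc _ = diagonal (Sum.elim c c) * (Xᵀ * Jmat n * X) * diagonal (Sum.elim c c) := by
        simp only [Matrix.transpose_mul, Matrix.diagonal_transpose, Matrix.mul_assoc]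
    _ = _ := by
        rw [hJ, ← Matrix.mul_assoc, ← Jmat_mul_diagonal, Matrix.mul_assoc, Matrix.mul_assoc,
          Matrix.diagonal_mul_diagonal, Matrix.diagonal_mul_diagonal]
        congr 2
        ext (i | i) <;> simp <;> ring

/-- The value of `fPen` at the scaled frame of the first `p` symplectic eigenvector pairs bounds
the value at any minimizer. -/
lemma fPen_min_le {n p : ℕ} (hpn : p ≤ n)
    {A : Matrix (Fin n ⊕ Fin n) (Fin n ⊕ Fin n) ℝ} {d : Fin n → ℝ}
    {S₀ : Matrix (Fin n ⊕ Fin n) (Fin n ⊕ Fin n) ℝ}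
    (hS₀symp : S₀ᵀ * Jmat n * S₀ = Jmat n)
    (hS₀diag : S₀ᵀ * A * S₀ = Matrix.diagonal (Sum.elim d d))
    {β : ℝ} (hβ : 0 < β) (hdβ : ∀ i, d (Fin.castLE hpn i) ≤ β)
    {X : Matrix (Fin n ⊕ Fin n) (Fin p ⊕ Fin p) ℝ}
    (hmin : ∀ Y, fPen n p A β X ≤ fPen n p A β Y) :
    fPen n p A β X ≤ β / 2 * ∑ i, (1 - (1 - d (Fin.castLE hpn i) / β) ^ 2) := by
  set c : Fin p → Fin n := Fin.castLE hpn
  have hc : Function.Injective c := Fin.castLE_injective hpn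
  set s : Fin p ⊕ Fin p → Fin n ⊕ Fin n := Sum.map c c with hs
  set Y := S₀.submatrix id s
  have hYA : Yᵀ * A * Y = diagonal (Sum.elim (d ∘ c) (d ∘ c)) := by
    have : Yᵀ * A * Y = (S₀ᵀ * A * S₀).submatrix s s := rfl
    rw [this, hS₀diag, Matrix.submatrix_diagonal _ _ (hc.sumMap hc), Sum.elim_comp_map]
  have hYJ : Yᵀ * Jmat n * Y = Jmat p * diagonal (Sum.elim (fun _ => 1) fun _ => 1) := by
    have : Yᵀ * Jmat n * Y = (S₀ᵀ * Jmat n * S₀).submatrix s s := rfl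
    rw [this, hS₀symp]
    have h1 : (Sum.elim (fun _ => 1) fun _ => 1 : Fin p ⊕ Fin p → ℝ) = fun _ => 1 := by
      ext (i | i) <;> rfl
    rw [h1, Matrix.diagonal_one, Matrix.mul_one]
    ext (i | i) (j | j) <;> simp [Jmat, hs, Matrix.one_apply, hc.eq_iff]
  have hsq (i) : √(1 - d (c i) / β) ^ 2 = 1 - d (c i) / β :=
    Real.sq_sqrt (sub_nonneg.mpr ((div_le_one hβ).mpr (hdβ i)))
  refine (hmin (Y * diagonal (Sum.elim (fun i => √(1 - d (c i) / β))
    fun i => √(1 - d (c i) / β)))).trans_eq (fPen_of_diagonal ?_ ?_)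
  · rw [transpose_conj_Jmat_mul_diagonal hYJ]
    simp only [hsq, mul_one]
  · rw [transpose_conj_mul_diagonal hYA]
    have hval (i : Fin p) : √(1 - d (c i) / β) ^ 2 * (d ∘ c) i =
        β * ((1 - d (c i) / β) * (1 - (1 - d (c i) / β))) := by
      rw [hsq, Function.comp_apply]
      field_simp
      ring
    simp only [hval]

/-- Stationary frames cannot have more small symplectic eigenvalues than `A` has. -/
lemma stationary_le {n p : ℕ} (hpn : p ≤ n)
    {A : Matrix (Fin n ⊕ Fin n) (Fin n ⊕ Fin n) ℝ} {d : Fin n → ℝ} (hmono : Monotone d)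
    {S₀ : Matrix (Fin n ⊕ Fin n) (Fin n ⊕ Fin n) ℝ}
    (hS₀symp : S₀ᵀ * Jmat n * S₀ = Jmat n)
    (hS₀diag : S₀ᵀ * A * S₀ = Matrix.diagonal (Sum.elim d d))
    {β : ℝ} (hβ : 0 < β) {X : Matrix (Fin n ⊕ Fin n) (Fin p ⊕ Fin p) ℝ} {h : Fin p → ℝ}
    (hanti : Antitone h) (hle : ∀ i, h i ≤ 1)
    (hJ : Xᵀ * Jmat n * X = Jmat p * diagonal (Sum.elim h h))
    (hX : A * X = β • (Jmat n * X * (Xᵀ * Jmat n * X - Jmat p)))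
    (k : Fin p) (hk : d (Fin.castLE hpn k) < β) : h k ≤ 1 - d (Fin.castLE hpn k) / β := by
  by_contra! hlt
  set D := diagonal (Sum.elim d d) with hD
  -- coordinates of the frame in the Williamson basis
  have hS₀ : (-(Jmat n * S₀ᵀ * Jmat n)) * S₀ = 1 := by
    rw [Matrix.neg_mul, Matrix.mul_assoc, Matrix.mul_assoc, ← Matrix.mul_assoc S₀ᵀ, hS₀symp,
      Jmat_mul_self, neg_neg]
  have hS₀' := mul_eq_one_comm.mp hS₀
  obtain ⟨U, rfl⟩ : ∃ U, X = S₀ * U :=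
    ⟨-(Jmat n * S₀ᵀ * Jmat n) * X, by rw [← Matrix.mul_assoc, hS₀', Matrix.one_mul]⟩
  have hJU : Uᵀ * Jmat n * U = Jmat p * diagonal (Sum.elim h h) := by
    rw [← hJ]
    conv_lhs => rw [← hS₀symp]
    simp only [Matrix.transpose_mul, Matrix.mul_assoc]
  set H' : Matrix (Fin p ⊕ Fin p) (Fin p ⊕ Fin p) ℝ :=
    diagonal (Sum.elim (fun i => h i - 1) fun i => h i - 1) with hH'
  have hDU : D * U = β • (Jmat n * U * (Jmat p * H')) := by
    rw [hJ, Jmat_mul_diagonal_sub, ← hH'] at hX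
    calc D * U = S₀ᵀ * (A * (S₀ * U)) := by
          rw [← hS₀diag]; simp only [Matrix.mul_assoc]
      _ = β • ((S₀ᵀ * Jmat n * S₀) * U * (Jmat p * H')) := by
          rw [hX, Matrix.mul_smul]; simp only [Matrix.mul_assoc]
      _ = _ := by rw [hS₀symp]
  have hDDU : D * (D * U) = β ^ 2 • (U * (H' * H')) := by
    calc D * (D * U) = β • (Jmat n * (D * U) * (Jmat p * H')) := by
          conv_lhs => rw [hDU]
          rw [Matrix.mul_smul, ← Matrix.mul_assoc D, ← Matrix.mul_assoc D, hD,
            ← Jmat_mul_diagonal, Matrix.mul_assoc (Jmat n)]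
      _ = β ^ 2 • ((Jmat n * Jmat n) * U * ((Jmat p * H') * (Jmat p * H'))) := by
          rw [hDU, Matrix.mul_smul, Matrix.smul_mul, smul_smul, sq]
          simp only [Matrix.mul_assoc]
      _ = β ^ 2 • ((Jmat n * Jmat n) * U * ((Jmat p * Jmat p) * (H' * H'))) := by
          congr 2
          rw [Matrix.mul_assoc, ← Matrix.mul_assoc H', ← Jmat_mul_diagonal]
          simp only [Matrix.mul_assoc, hH']
      _ = _ := by simp [Jmat_mul_self]
  have hsupp (j : Fin n ⊕ Fin n) (i : Fin p ⊕ Fin p) (hj : (k : ℕ) ≤ Sum.elim Fin.val Fin.val j)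
      (hi : Sum.elim id id i ≤ k) : U j i = 0 := by
    have h1 := congrFun (congrFun hDDU j) i
    rw [hD, hH', Matrix.diagonal_mul_diagonal, Matrix.diagonal_mul, Matrix.diagonal_mul,
      Matrix.smul_apply, Matrix.mul_diagonal, smul_eq_mul] at h1
    have key (x : Fin n) (y : Fin p) (hx : (k : ℕ) ≤ x) (hy : y ≤ k) (u : ℝ)
        (hu : d x * (d x * u) = β ^ 2 * (u * ((h y - 1) * (h y - 1)))) : u = 0 := by
      have h2 : d (Fin.castLE hpn k) ≤ d x := hmono hx
      have h3 : h k ≤ h y := hanti hy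
      have h4 : β * (1 - h y) < d x := by
        have : β * (1 - d (Fin.castLE hpn k) / β) = β - d (Fin.castLE hpn k) := by
          field_simp
        nlinarith
      have h5 : 0 ≤ β * (1 - h y) := mul_nonneg hβ.le (sub_nonneg.mpr (hle y))
      have h6 : u * (d x ^ 2 - (β * (1 - h y)) ^ 2) = 0 := by linear_combination hu
      have h7 : 0 < d x ^ 2 - (β * (1 - h y)) ^ 2 := by nlinarith
      exact (mul_eq_zero.mp h6).resolve_right h7.ne'
    rcases j with j | j <;> rcases i with i | i <;> exact key j i hj hi _ h1
  -- a nonzero combination of the first `k + 1` pairs that vanishes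
  let c : Fin (k + 1) → Fin p := Fin.castLE k.2
  have hc : Function.Injective c := Fin.castLE_injective _
  let r : Fin k → Fin n := Fin.castLE (k.2.le.trans hpn)
  let V := U.submatrix id (Sum.map c c)
  obtain ⟨w, hw0, hw⟩ : ∃ w : Fin (k + 1) ⊕ Fin (k + 1) → ℝ, w ≠ 0 ∧
      (U.submatrix (Sum.map r r) (Sum.map c c)) *ᵥ w = 0 := by
    have hlt : Module.finrank ℝ (Fin k ⊕ Fin k → ℝ) <
        Module.finrank ℝ (Fin (k + 1) ⊕ Fin (k + 1) → ℝ) := by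
      simp only [Module.finrank_fintype_fun_eq_card, Fintype.card_sum, Fintype.card_fin]
      omega
    obtain ⟨w, hw, hw0⟩ := Submodule.exists_mem_ne_zero_of_ne_bot
      (LinearMap.ker_ne_bot_of_finrank_lt
        (f := (U.submatrix (Sum.map r r) (Sum.map c c)).mulVecLin) hlt)
    exact ⟨w, hw0, hw⟩
  have hVw : V *ᵥ w = 0 := by
    ext j
    by_cases hj : (k : ℕ) ≤ Sum.elim Fin.val Fin.val j
    · rw [Matrix.mulVec, dotProduct, Pi.zero_apply]
      refine Finset.sum_eq_zero fun i _ => ?_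
      have : V j i = 0 := hsupp j _ hj (by
        rcases i with i | i <;> exact Nat.lt_succ_iff.mp i.2)
      rw [this, zero_mul]
    · rcases j with j | j
      · exact congrFun hw (Sum.inl ⟨j, not_le.mp hj⟩)
      · exact congrFun hw (Sum.inr ⟨j, not_le.mp hj⟩)
  have hVJV : Vᵀ * Jmat n * V = Jmat (k + 1) * diagonal (Sum.elim (h ∘ c) (h ∘ c)) := by
    have : Vᵀ * Jmat n * V = (Uᵀ * Jmat n * U).submatrix (Sum.map c c) (Sum.map c c) := rfl
    rw [this, hJU]
    ext (i | i) (j | j) <;> simp [Jmat, Matrix.one_apply, hc.eq_iff]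
  have hz : diagonal (Sum.elim (h ∘ c) (h ∘ c)) *ᵥ w = 0 := by
    calc _ = -((Jmat (k + 1) * (Jmat (k + 1) * diagonal (Sum.elim (h ∘ c) (h ∘ c)))) *ᵥ w) := by
          rw [← Matrix.mul_assoc, Jmat_mul_self, Matrix.neg_mul, Matrix.one_mul,
            Matrix.neg_mulVec, neg_neg]
      _ = 0 := by
          rw [← hVJV, ← Matrix.mulVec_mulVec, ← Matrix.mulVec_mulVec, hVw]
          simp
  have hpos (i : Fin (k + 1)) : h (c i) ≠ 0 := by
    have h3 : h k ≤ h (c i) := hanti (Nat.lt_succ_iff.mp i.2 : c i ≤ k)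
    have h4 : d (Fin.castLE hpn k) / β < 1 := (div_lt_one hβ).mpr hk
    linarith
  apply hw0
  ext i
  have h1 := congrFun hz i
  rw [Matrix.mulVec_diagonal] at h1
  rcases i with i | i <;> exact (mul_eq_zero.mp h1).resolve_left (hpos i)

theorem stmt5 (n p : ℕ) (hp : 1 ≤ p) (hpn : p ≤ n)
    (A : Matrix (Fin n ⊕ Fin n) (Fin n ⊕ Fin n) ℝ) (hA : A.PosDef)
    (d : Fin n → ℝ) (hmono : Monotone d) (hdpos : ∀ i, 0 < d i)
    (S₀ : Matrix (Fin n ⊕ Fin n) (Fin n ⊕ Fin n) ℝ)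
    (hS₀symp : S₀ᵀ * Jmat n * S₀ = Jmat n)
    (hS₀diag : S₀ᵀ * A * S₀ = Matrix.diagonal (Sum.elim d d))
    (β : ℝ) (hβ : d ⟨p - 1, by omega⟩ < β)
    (X : Matrix (Fin n ⊕ Fin n) (Fin p ⊕ Fin p) ℝ)
    (hmin : ∀ Y, fPen n p A β X ≤ fPen n p A β Y) :
    ∃ (S : Matrix (Fin n ⊕ Fin n) (Fin p ⊕ Fin p) ℝ)
      (T : Matrix (Fin p ⊕ Fin p) (Fin p ⊕ Fin p) ℝ),
      Sᵀ * Jmat n * S = Jmat p ∧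
      Sᵀ * A * S =
        Matrix.diagonal (Sum.elim (fun i => d (Fin.castLE hpn i)) fun i => d (Fin.castLE hpn i)) ∧
      Tᵀ * Jmat p * T = Jmat p ∧ Tᵀ * T = 1 ∧
      X = S * Matrix.diagonal
            (Sum.elim (fun i => Real.sqrt (1 - d (Fin.castLE hpn i) / β))
              fun i => Real.sqrt (1 - d (Fin.castLE hpn i) / β)) * Tᵀ := by
  have hdβ (i : Fin p) : d (Fin.castLE hpn i) < β :=
    (hmono (Fin.mk_le_mk.mpr (Nat.le_sub_one_of_lt i.2))).trans_lt hβ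
  have hβ0 : 0 < β := (hdpos _).trans hβ
  have hAt : Aᵀ = A := hA.isHermitian
  have hgrad {X : Matrix (Fin n ⊕ Fin n) (Fin p ⊕ Fin p) ℝ}
      (hmin : ∀ Y, fPen n p A β X ≤ fPen n p A β Y) :
      A * X = β • (Jmat n * X * (Xᵀ * Jmat n * X - Jmat p)) :=
    sub_eq_zero.mp (gradPen_eq_zero_of_isMin hAt hmin)
  have hgrad' {X : Matrix (Fin n ⊕ Fin n) (Fin p ⊕ Fin p) ℝ}
      (hmin : ∀ Y, fPen n p A β X ≤ fPen n p A β Y) :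
      Xᵀ * A * X = β • (Xᵀ * Jmat n * X * (Xᵀ * Jmat n * X - Jmat p)) := by
    rw [Matrix.mul_assoc, hgrad hmin, Matrix.mul_smul]
    simp only [Matrix.mul_assoc]
  -- `XᵀJX` commutes with `J`
  obtain ⟨K, hK⟩ : ∃ K, Xᵀ * Jmat n * X = K := ⟨_, rfl⟩
  have hKt : Kᵀ = -K := hK ▸ transpose_conj_Jmat X
  have hKJ : K * Jmat p = Jmat p * K := by
    have h1 := hgrad' hmin
    rw [hK] at h1
    have h2 : (Xᵀ * A * X)ᵀ = Xᵀ * A * X := by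
      simp only [Matrix.transpose_mul, Matrix.transpose_transpose, hAt, Matrix.mul_assoc]
    rw [h1, Matrix.transpose_smul] at h2
    have h3 := smul_right_injective _ hβ0.ne' h2
    rw [Matrix.transpose_mul, Matrix.transpose_sub, hKt, Jmat_transpose, Matrix.mul_sub,
      Matrix.sub_mul] at h3
    simpa using h3.symm
  obtain ⟨T, h, hanti, hTJ, hTT, hTN⟩ := exists_orthosymplectic_diagonal (N := -(Jmat p * K))
    (by rw [Matrix.transpose_neg, Matrix.transpose_mul, hKt, Jmat_transpose, Matrix.neg_mul,
      Matrix.mul_neg, neg_neg, hKJ])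
    (by rw [Matrix.mul_neg, Matrix.neg_mul, Matrix.mul_assoc, hKJ])
  have hTT' : T * Tᵀ = 1 := mul_eq_one_comm.mp hTT
  have hTJ' : Tᵀ * Jmat p = Jmat p * Tᵀ := by
    rw [← hTJ, Matrix.mul_assoc _ T, hTT', Matrix.mul_one, hTJ]
  obtain ⟨X', hX'⟩ : ∃ X', X * T = X' := ⟨_, rfl⟩
  have hXX' : X = X' * Tᵀ := by rw [← hX', Matrix.mul_assoc, hTT', Matrix.mul_one]
  have hmin' (Y) : fPen n p A β X' ≤ fPen n p A β Y := by
    rw [← hX', fPen_mul_orthosymplectic A β X hTJ hTT]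
    exact hmin Y
  have hJ : X'ᵀ * Jmat n * X' = Jmat p * diagonal (Sum.elim h h) := by
    rw [← hTN, Matrix.mul_neg, Matrix.neg_mul, Matrix.mul_neg, ← Matrix.mul_assoc Tᵀ, hTJ',
      ← Matrix.mul_assoc, ← Matrix.mul_assoc, ← Matrix.mul_assoc, Jmat_mul_self, ← hX', ← hK]
    simp [Matrix.transpose_mul, Matrix.mul_assoc]
  have hXA : X'ᵀ * A * X' = diagonal
      (Sum.elim (fun i => β * (h i * (1 - h i))) fun i => β * (h i * (1 - h i))) := by
    rw [hgrad' hmin', hJ, Jmat_mul_diagonal_sub]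
    nth_rewrite 1 [Jmat_mul_diagonal]
    rw [Matrix.mul_assoc, ← Matrix.mul_assoc (Jmat p), Jmat_mul_self, Matrix.neg_mul,
      Matrix.one_mul, Matrix.mul_neg, Matrix.diagonal_mul_diagonal, Matrix.diagonal_neg,
      ← Matrix.diagonal_smul]
    congr 1
    ext (i | i) <;> simp <;> ring
  have hpsd : (X'ᵀ * A * X').PosSemidef := hA.posSemidef.conjTranspose_mul_mul_same X'
  have hh (i) : 0 ≤ h i * (1 - h i) := by
    have h1 := hpsd.diag_nonneg (i := Sum.inl i)
    rw [hXA, Matrix.diagonal_apply_eq, Sum.elim_inl] at h1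
    exact nonneg_of_mul_nonneg_right h1 hβ0
  have hle (i) : h i ≤ 1 := by nlinarith [hh i]
  have hnonneg (i) : 0 ≤ h i := by nlinarith [hh i]
  have hη (i) : h i ≤ 1 - d (Fin.castLE hpn i) / β :=
    stationary_le hpn hmono hS₀symp hS₀diag hβ0 hanti hle hJ (hgrad hmin') i (hdβ i)
  have hηpos (i) : 0 < 1 - d (Fin.castLE hpn i) / β :=
    sub_pos.mpr ((div_lt_one hβ0).mpr (hdβ i))
  have hsq (i) : h i ^ 2 ≤ (1 - d (Fin.castLE hpn i) / β) ^ 2 :=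
    pow_le_pow_left₀ (hnonneg i) (hη i) 2
  have hval := fPen_min_le hpn hS₀symp hS₀diag hβ0 (fun i => (hdβ i).le) hmin'
  rw [fPen_of_diagonal hJ hXA, mul_le_mul_iff_right₀ (half_pos hβ0), Finset.sum_sub_distrib,
    Finset.sum_sub_distrib, sub_le_sub_iff_left] at hval
  have heq (i) : h i = 1 - d (Fin.castLE hpn i) / β := by
    have h1 := (Finset.sum_eq_sum_iff_of_le fun i _ => hsq i).mp
      (le_antisymm (Finset.sum_le_sum fun i _ => hsq i) hval) i (Finset.mem_univ i)
    exact (pow_left_inj₀ (hnonneg i) (hηpos i).le two_ne_zero).mp h1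
  obtain rfl : h = fun i => 1 - d (Fin.castLE hpn i) / β := funext heq
  have hsqrt (i) : (√(1 - d (Fin.castLE hpn i) / β))⁻¹ ^ 2 = (1 - d (Fin.castLE hpn i) / β)⁻¹ := by
    rw [inv_pow, Real.sq_sqrt (hηpos i).le]
  refine ⟨X' * diagonal (Sum.elim (fun i => (√(1 - d (Fin.castLE hpn i) / β))⁻¹)
    fun i => (√(1 - d (Fin.castLE hpn i) / β))⁻¹), T, ?_, ?_, hTJ, hTT, ?_⟩
  · rw [transpose_conj_Jmat_mul_diagonal hJ]
    simp only [hsqrt, inv_mul_cancel₀ (hηpos _).ne']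
    rw [← Matrix.mul_one (Jmat p), Matrix.mul_assoc, Matrix.one_mul, ← Matrix.diagonal_one]
    congr 2
    ext (i | i) <;> rfl
  · rw [transpose_conj_mul_diagonal hXA]
    have hval' (i : Fin p) : (√(1 - d (Fin.castLE hpn i) / β))⁻¹ ^ 2 *
        (β * ((1 - d (Fin.castLE hpn i) / β) *
        (1 - (1 - d (Fin.castLE hpn i) / β)))) = d (Fin.castLE hpn i) := by
      rw [hsqrt, mul_left_comm, inv_mul_cancel_left₀ (hηpos i).ne', sub_sub_cancel,
        mul_div_cancel₀ _ hβ0.ne']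
    simp only [hval']
  · rw [Matrix.mul_assoc X', Matrix.diagonal_mul_diagonal]
    have h1 : (fun i => Sum.elim (fun i => (√(1 - d (Fin.castLE hpn i) / β))⁻¹)
        (fun i => (√(1 - d (Fin.castLE hpn i) / β))⁻¹) i *
        Sum.elim (fun i => √(1 - d (Fin.castLE hpn i) / β))
        (fun i => √(1 - d (Fin.castLE hpn i) / β)) i) = (1 : Fin p ⊕ Fin p → ℝ) := by
      ext (i | i) <;> exact inv_mul_cancel₀ (Real.sqrt_pos.mpr (hηpos i)).ne'
    rw [h1, Matrix.diagonal_one', Matrix.mul_one, hXX']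
end
end
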